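/- There exist nonempty regular closed subsets a, b, c of ℝ² that are pairwise externally connected, i.e. EC(a,b), EC(a,c) and EC(b,c) hold; but there do not exist nonempty convex regular closed subsets a, b, c of ℝ that are pairwise externally connected. (There is a consistent atomic RCC8 network over {EC} with no convex solution in ℝ.) -/

import Mathlib

/-- A set is regular closed if it equals the closure of its interior. -/
def RegClosed {α : Type*} [TopologicalSpace α] (X : Set α) : Prop :=
  closure (interior X) = X

/-- RCC8: disconnected. -/
def DC {α : Type*} (a b : Set α) : Prop := a ∩ b = ∅

/-- RCC8: externally connected. -/
def EC {α : Type*} [TopologicalSpace α] (a b : Set α) : Prop :=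
  (a ∩ b).Nonempty ∧ interior a ∩ interior b = ∅

/-- RCC8: partially overlaps. -/
def PO {α : Type*} [TopologicalSpace α] (a b : Set α) : Prop :=
  (interior a ∩ interior b).Nonempty ∧ ¬ a ⊆ b ∧ ¬ b ⊆ a

/-- RCC8: tangential proper part. -/
def TPP {α : Type*} [TopologicalSpace α] (a b : Set α) : Prop :=
  a ⊂ b ∧ ¬ a ⊆ interior b

/-- RCC8: non-tangential proper part. -/
def NTPP {α : Type*} [TopologicalSpace α] (a b : Set α) : Prop :=
  a ⊆ interior b ∧ a ≠ b

/-- RCC5: discrete from. -/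
def DR {α : Type*} [TopologicalSpace α] (a b : Set α) : Prop :=
  interior a ∩ interior b = ∅

/-- RCC5: proper part. -/
def PP {α : Type*} (a b : Set α) : Prop := a ⊂ b

open Set

theorem IsOpen.regClosed_closure {α : Type*} [TopologicalSpace α] {U : Set α} (hU : IsOpen U) :
    RegClosed (closure U) :=
  (closure_mono interior_subset |>.trans closure_closure.subset).antisymm
    (closure_mono (interior_maximal subset_closure hU))

theorem IsOpen.ec_closure {α : Type*} [TopologicalSpace α] {U V : Set α}
    (hV : IsOpen V) (h : Disjoint U V) {x : α} (hxU : x ∈ closure U) (hxV : x ∈ closure V) :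
    EC (closure U) (closure V) :=
  ⟨⟨x, hxU, hxV⟩, Set.disjoint_iff_inter_eq_empty.mp <|
    (((h.closure_left hV).mono_left interior_subset).closure_right isOpen_interior).mono_right
      interior_subset⟩

theorem zero_mem_closure_of_forall_pos_smul_mem {E : Type*} [AddCommGroup E] [Module ℝ E]
    [TopologicalSpace E] [ContinuousSMul ℝ E] {U : Set E} {v : E}
    (h : ∀ t : ℝ, 0 < t → t • v ∈ U) : (0 : E) ∈ closure U := by
  have hc : Continuous fun t : ℝ => t • v := by fun_prop
  have h0 : (0 : ℝ) ∈ closure (Ioi 0) := by simp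
  simpa using map_mem_closure hc h0 h

theorem RegClosed.notMem_of_mem_interior {α : Type*} [TopologicalSpace α] {a b : Set α}
    (ha : RegClosed a) (h : interior a ∩ interior b = ∅) {x : α} (hx : x ∈ interior b) :
    x ∉ a := fun hxa =>
  (((Set.disjoint_iff_inter_eq_empty.mpr h).closure_left isOpen_interior).notMem_of_mem_right hx)
    (ha.symm ▸ hxa)

theorem RegClosed.nonempty_interior {α : Type*} [TopologicalSpace α] {a : Set α}
    (ha : RegClosed a) (hne : a.Nonempty) : (interior a).Nonempty :=
  closure_nonempty_iff.mp (ha.symm ▸ hne)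

theorem Set.OrdConnected.mem_or_mem_of_mem_inter {α : Type*} [LinearOrder α] {a c : Set α}
    (ha : a.OrdConnected) (hc : c.OrdConnected) (h : (a ∩ c).Nonempty) {x y z : α}
    (hx : x ∈ a) (hz : z ∈ c) (hxy : x ≤ y) (hyz : y ≤ z) : y ∈ a ∨ y ∈ c := by
  obtain ⟨p, hpa, hpc⟩ := h
  rcases le_total p y with hp | hp
  · exact Or.inr (hc.out hpc hz ⟨hp, hyz⟩)
  · exact Or.inl (ha.out hx hpa ⟨hxy, hp⟩)

theorem EC.symm {α : Type*} [TopologicalSpace α] {a b : Set α} (h : EC a b) : EC b a :=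
  ⟨inter_comm a b ▸ h.1, inter_comm (interior a) _ ▸ h.2⟩

/-- The interior of `b` does not meet the gap between two touching intervals `a` and `c`. -/
theorem EC.not_between {α : Type*} [LinearOrder α] [TopologicalSpace α] {a b c : Set α}
    (ha : a.OrdConnected) (hc : c.OrdConnected) (hra : RegClosed a) (hrc : RegClosed c)
    (hab : EC a b) (hac : EC a c) (hcb : EC c b) {x y z : α} (hx : x ∈ interior a)
    (hy : y ∈ interior b) (hz : z ∈ interior c) : ¬ (x ≤ y ∧ y ≤ z) := fun h =>
  (ha.mem_or_mem_of_mem_inter hc hac.1 (interior_subset hx) (interior_subset hz) h.1 h.2).elim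
    (hra.notMem_of_mem_interior hab.2 hy) (hrc.notMem_of_mem_interior hcb.2 hy)

/-- There is a consistent atomic RCC8 network over {EC} with no convex solution in ℝ. -/
theorem statement6 :
    (∃ a b c : Set (EuclideanSpace ℝ (Fin 2)),
      a.Nonempty ∧ b.Nonempty ∧ c.Nonempty ∧
      RegClosed a ∧ RegClosed b ∧ RegClosed c ∧
      EC a b ∧ EC a c ∧ EC b c) ∧
    ¬ (∃ a b c : Set ℝ,
      a.Nonempty ∧ b.Nonempty ∧ c.Nonempty ∧
      Convex ℝ a ∧ Convex ℝ b ∧ Convex ℝ c ∧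
      RegClosed a ∧ RegClosed b ∧ RegClosed c ∧
      EC a b ∧ EC a c ∧ EC b c) := by
  refine ⟨?_, ?_⟩
  · let U : Set (EuclideanSpace ℝ (Fin 2)) := {x | x 0 < 0}
    let V : Set (EuclideanSpace ℝ (Fin 2)) := {x | 0 < x 0 ∧ 0 < x 1}
    let W : Set (EuclideanSpace ℝ (Fin 2)) := {x | 0 < x 0 ∧ x 1 < 0}
    have hU : IsOpen U := isOpen_lt (by fun_prop) (by fun_prop)
    have hV : IsOpen V :=
      IsOpen.and (isOpen_lt (by fun_prop) (by fun_prop)) (isOpen_lt (by fun_prop) (by fun_prop))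
    have hW : IsOpen W :=
      IsOpen.and (isOpen_lt (by fun_prop) (by fun_prop)) (isOpen_lt (by fun_prop) (by fun_prop))
    have hUV : Disjoint U V := Set.disjoint_left.mpr fun x hx hx' => lt_asymm hx hx'.1
    have hUW : Disjoint U W := Set.disjoint_left.mpr fun x hx hx' => lt_asymm hx hx'.1
    have hVW : Disjoint V W := Set.disjoint_left.mpr fun x hx hx' => lt_asymm hx.2 hx'.2
    have h0U : 0 ∈ closure U :=
      zero_mem_closure_of_forall_pos_smul_mem (v := !₂[-1, 0]) fun t ht => by simp [U, ht]
    have h0V : 0 ∈ closure V :=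
      zero_mem_closure_of_forall_pos_smul_mem (v := !₂[1, 1]) fun t ht => by simp [V, ht]
    have h0W : 0 ∈ closure W :=
      zero_mem_closure_of_forall_pos_smul_mem (v := !₂[1, -1]) fun t ht => by simp [W, ht]
    exact ⟨closure U, closure V, closure W, ⟨0, h0U⟩, ⟨0, h0V⟩, ⟨0, h0W⟩,
      hU.regClosed_closure, hV.regClosed_closure, hW.regClosed_closure,
      hV.ec_closure hUV h0U h0V, hW.ec_closure hUW h0U h0W, hW.ec_closure hVW h0V h0W⟩
  · rintro ⟨a, b, c, ha, hb, hc, hca, hcb, hcc, hra, hrb, hrc, hab, hac, hbc⟩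
    obtain ⟨x, hx⟩ := hra.nonempty_interior ha
    obtain ⟨y, hy⟩ := hrb.nonempty_interior hb
    obtain ⟨z, hz⟩ := hrc.nonempty_interior hc
    replace hca := hca.ordConnected
    replace hcb := hcb.ordConnected
    replace hcc := hcc.ordConnected
    have h₁ := EC.not_between hca hcc hra hrc hab hac hbc.symm hx hy hz
    have h₂ := EC.not_between hcc hca hrc hra hbc.symm hac.symm hab hz hy hx
    have h₃ := EC.not_between hcb hcc hrb hrc hab.symm hbc hac.symm hy hx hz
    have h₄ := EC.not_between hcc hcb hrc hrb hac.symm hbc.symm hab.symm hz hx hy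
    have h₅ := EC.not_between hca hcb hra hrb hac hab hbc hx hz hy
    have h₆ := EC.not_between hcb hca hrb hra hbc hab.symm hac hy hz hx
    grind
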